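/- Let X be a Poisson point process on a measurable space with finite intensity measure having density λ₁ + λ₂ with λ₁, λ₂ ≥ 0 integrable, and let P₁, P₂ be the laws of Poisson point processes with intensities λ₁, λ₂ respectively (both absolutely continuous with respect to a common dominating PPP law). Then the squared Hellinger distance satisfies H²(P₁, P₂) = 2(1 - exp(-(1/2)∫(√λ₁ - √λ₂)² dμ)), and consequently H²(P₁,P₂) ≤ ∫(√λ₁(x) - √λ₂(x))² dμ(x). -/

import Mathlib

open Set MeasureTheory

/-- The law of a Poisson point process with finite intensity measure `ν`, represented on the
space of finite ordered point configurations `(n : ℕ) × (Fin n → E)`: the number of points is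
Poisson with mean `ν univ` and, given `n` points, they are i.i.d. with law `ν / ν univ`;
equivalently, the `n`-point contribution has weight `exp(-ν univ) / n!` times the `n`-fold
product of the (unnormalized) intensity `ν`. -/
noncomputable def pppLaw {E : Type*} [MeasurableSpace E] (ν : Measure E) [SigmaFinite ν] :
    Measure ((n : ℕ) × (Fin n → E)) :=
  Measure.sum (fun n => (ENNReal.ofReal (Real.exp (-(ν Set.univ).toReal)) / n.factorial) •
    Measure.map (Sigma.mk n) (Measure.pi (fun _ : Fin n => ν)))

/-- Squared Hellinger distance between two measures, computed with respect to the dominating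
measure `P + Q`. -/
noncomputable def hellingerSq {Ω : Type*} [MeasurableSpace Ω] (P Q : Measure Ω) : ℝ :=
  ∫ ω, (Real.sqrt ((P.rnDeriv (P + Q)) ω).toReal -
    Real.sqrt ((Q.rnDeriv (P + Q)) ω).toReal) ^ 2 ∂(P + Q)

open scoped ENNReal

section ProductMeasures

/-- Fubini for products of functions of separate coordinates, for the lower integral. -/
theorem lintegral_pi_fin_prod {E : Type*} [MeasurableSpace E] (n : ℕ) (μ : Fin n → Measure E)
    [∀ i, SigmaFinite (μ i)] (f : Fin n → E → ℝ≥0∞) (hf : ∀ i, Measurable (f i)) :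
    ∫⁻ x, ∏ i, f i (x i) ∂Measure.pi μ = ∏ i, ∫⁻ y, f i y ∂μ i := by
  induction n with
  | zero => simp
  | succ n ih =>
    have hmp := (measurePreserving_piFinSuccAbove μ 0).symm
    rw [← hmp.lintegral_comp (by fun_prop)]
    simp only [MeasurableEquiv.piFinSuccAbove_symm_apply, Fin.insertNthEquiv, Fin.prod_univ_succ,
      Fin.insertNth_zero, Equiv.coe_fn_mk, Fin.cons_zero, Fin.cons_succ, Fin.zero_succAbove]
    simp only [cast_eq]
    rw [lintegral_prod_mul (g := fun x : Fin n → E => ∏ i, f i.succ (x i)) (hf 0).aemeasurable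
        (Finset.measurable_fun_prod _ fun i _ =>
          (hf i.succ).comp (measurable_pi_apply i)).aemeasurable,
      ih (fun i => μ i.succ) (fun i => f i.succ) (fun i => hf i.succ)]

theorem pi_fin_withDensity {E : Type*} [MeasurableSpace E] (n : ℕ) (μ : Measure E)
    [SigmaFinite μ] (f : E → ℝ≥0∞) (hf : Measurable f) [SigmaFinite (μ.withDensity f)] :
    Measure.pi (fun _ : Fin n => μ.withDensity f) =
      (Measure.pi (fun _ : Fin n => μ)).withDensity (fun x => ∏ i, f (x i)) := by
  refine (Measure.pi_eq fun s hs => ?_)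
  rw [withDensity_apply _ (MeasurableSet.univ_pi hs), Measure.restrict_pi_pi,
    lintegral_pi_fin_prod n _ (fun _ => f) (fun _ => hf)]
  exact Finset.prod_congr rfl fun i _ => (withDensity_apply _ (hs i)).symm

end ProductMeasures

section Hellinger

variable {Ω : Type*} [MeasurableSpace Ω] {ρ : Measure Ω} {p q : Ω → ℝ}

theorem rnDeriv_withDensity_add_toReal (hpm : Measurable p) (hqm : Measurable q)
    (hp0 : ∀ ω, 0 ≤ p ω) (hq0 : ∀ ω, 0 ≤ q ω) {P S : Measure Ω} [SigmaFinite S]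
    (hP : P = ρ.withDensity (fun ω => ENNReal.ofReal (p ω)))
    (hS : S = ρ.withDensity (fun ω => ENNReal.ofReal (p ω + q ω))) :
    ∀ᵐ ω ∂S, (P.rnDeriv S ω).toReal = p ω / (p ω + q ω) := by
  have hPS : P = S.withDensity (fun ω => ENNReal.ofReal (p ω / (p ω + q ω))) := by
    rw [hP, hS, ← withDensity_mul _ (by fun_prop) (by fun_prop)]
    congr 1
    ext ω
    have := hp0 ω
    have := hq0 ω
    rw [Pi.mul_apply, ← ENNReal.ofReal_mul (by positivity)]
    congr 1
    by_cases h : p ω + q ω = 0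
    · rw [h, zero_mul]; linarith
    · field_simp
  rw [hPS]
  filter_upwards [Measure.rnDeriv_withDensity S
    (f := fun ω => ENNReal.ofReal (p ω / (p ω + q ω))) (by fun_prop)] with ω h
  rw [h, ENNReal.toReal_ofReal (div_nonneg (hp0 ω) (add_nonneg (hp0 ω) (hq0 ω)))]

/-- The squared Hellinger distance may be computed with respect to any dominating measure. -/
theorem hellingerSq_withDensity (hpm : Measurable p) (hqm : Measurable q)
    (hp0 : ∀ ω, 0 ≤ p ω) (hq0 : ∀ ω, 0 ≤ q ω) (hpi : Integrable p ρ) (hqi : Integrable q ρ) :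
    hellingerSq (ρ.withDensity (fun ω => ENNReal.ofReal (p ω)))
      (ρ.withDensity (fun ω => ENNReal.ofReal (q ω))) =
      ∫ ω, (Real.sqrt (p ω) - Real.sqrt (q ω)) ^ 2 ∂ρ := by
  unfold hellingerSq
  have hS : ρ.withDensity (fun ω => ENNReal.ofReal (p ω)) +
      ρ.withDensity (fun ω => ENNReal.ofReal (q ω)) =
      ρ.withDensity (fun ω => ENNReal.ofReal (p ω + q ω)) := by
    rw [← withDensity_add_left (by fun_prop)]
    congr 1
    ext ω
    exact (ENNReal.ofReal_add (hp0 ω) (hq0 ω)).symm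
  rw [hS]
  have : IsFiniteMeasure (ρ.withDensity (fun ω => ENNReal.ofReal (p ω + q ω))) :=
    isFiniteMeasure_withDensity_ofReal (hpi.add hqi).2
  have h1 := rnDeriv_withDensity_add_toReal (ρ := ρ) hpm hqm hp0 hq0 rfl rfl
  have h2 := rnDeriv_withDensity_add_toReal (ρ := ρ)
    (S := ρ.withDensity (fun ω => ENNReal.ofReal (p ω + q ω))) hqm hpm hq0 hp0 rfl
    (by simp only [add_comm])
  rw [integral_congr_ae (g := fun ω => (Real.sqrt (p ω / (p ω + q ω)) -
    Real.sqrt (q ω / (p ω + q ω))) ^ 2)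
    (by filter_upwards [h1, h2] with ω h h'; rw [h, h', add_comm (q ω)]),
    integral_withDensity_eq_integral_toReal_smul (by fun_prop) (by simp)]
  refine integral_congr_ae (.of_forall fun ω => ?_)
  have hp := hp0 ω
  have hq := hq0 ω
  have hs : 0 ≤ p ω + q ω := by positivity
  simp only [smul_eq_mul]
  rw [ENNReal.toReal_ofReal hs, Real.sqrt_div hp, Real.sqrt_div hq, ← sub_div, div_pow,
    Real.sq_sqrt hs]
  by_cases h : p ω + q ω = 0
  · have hp' : p ω = 0 := by linarith
    have hq' : q ω = 0 := by linarith
    simp [hp', hq']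
  · field_simp

theorem integrable_sqrt_mul_sqrt (hpm : Measurable p) (hqm : Measurable q)
    (hp0 : ∀ ω, 0 ≤ p ω) (hq0 : ∀ ω, 0 ≤ q ω) (hpi : Integrable p ρ) (hqi : Integrable q ρ) :
    Integrable (fun ω => Real.sqrt (p ω) * Real.sqrt (q ω)) ρ := by
  refine (hpi.add hqi).mono' (by fun_prop) (.of_forall fun ω => ?_)
  rw [Real.norm_of_nonneg (by positivity), Pi.add_apply]
  nlinarith [Real.sq_sqrt (hp0 ω), Real.sq_sqrt (hq0 ω),
    sq_nonneg (Real.sqrt (p ω) - Real.sqrt (q ω)),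
    sq_nonneg (Real.sqrt (p ω) + Real.sqrt (q ω))]

theorem integral_sqrt_sub_sqrt_sq (hpm : Measurable p) (hqm : Measurable q)
    (hp0 : ∀ ω, 0 ≤ p ω) (hq0 : ∀ ω, 0 ≤ q ω) (hpi : Integrable p ρ) (hqi : Integrable q ρ) :
    ∫ ω, (Real.sqrt (p ω) - Real.sqrt (q ω)) ^ 2 ∂ρ =
      ∫ ω, p ω ∂ρ + ∫ ω, q ω ∂ρ - 2 * ∫ ω, Real.sqrt (p ω) * Real.sqrt (q ω) ∂ρ := by
  have hpq := integrable_sqrt_mul_sqrt hpm hqm hp0 hq0 hpi hqi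
  rw [← integral_const_mul, ← integral_add hpi hqi,
    ← integral_sub (hpi.fun_add hqi) (hpq.const_mul 2)]
  refine integral_congr_ae (.of_forall fun ω => ?_)
  simp only [sub_sq, Real.sq_sqrt (hp0 ω), Real.sq_sqrt (hq0 ω)]
  ring

end Hellinger

section PoissonDensity

variable {E : Type*} {c : ℝ} {f : E → ℝ}

/-- The function `c / n! * ∏ i, f (x i)` on configurations. -/
noncomputable def configDensity (c : ℝ) (f : E → ℝ) (ω : (n : ℕ) × (Fin n → E)) : ℝ :=
  c / ω.1.factorial * ∏ i, f (ω.2 i)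

theorem configDensity_nonneg (hc : 0 ≤ c) (hf : ∀ x, 0 ≤ f x) (ω : (n : ℕ) × (Fin n → E)) :
    0 ≤ configDensity c f ω :=
  mul_nonneg (by positivity) (Finset.prod_nonneg fun _ _ => hf _)

theorem ofReal_configDensity (hc : 0 ≤ c) (hf : ∀ x, 0 ≤ f x) (n : ℕ) (x : Fin n → E) :
    ENNReal.ofReal (configDensity c f ⟨n, x⟩) =
      ENNReal.ofReal c / n.factorial * ∏ i, ENNReal.ofReal (f (x i)) := by
  unfold configDensity
  rw [ENNReal.ofReal_mul (by positivity), ENNReal.ofReal_div_of_pos (by positivity),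
    ENNReal.ofReal_natCast, ENNReal.ofReal_prod_of_nonneg fun _ _ => hf _]

theorem sqrt_configDensity (hc : 0 ≤ c) (hf : ∀ x, 0 ≤ f x) (ω : (n : ℕ) × (Fin n → E)) :
    Real.sqrt (configDensity c f ω) =
      Real.sqrt c / Real.sqrt ω.1.factorial * ∏ i, Real.sqrt (f (ω.2 i)) := by
  unfold configDensity
  rw [Real.sqrt_mul (by positivity), Real.sqrt_div hc, Real.sqrt_prod _ fun _ _ => hf _]

theorem sqrt_mul_sqrt_configDensity {d : ℝ} {g : E → ℝ} (hc : 0 ≤ c) (hd : 0 ≤ d)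
    (hf : ∀ x, 0 ≤ f x) (hg : ∀ x, 0 ≤ g x) (ω : (n : ℕ) × (Fin n → E)) :
    Real.sqrt (configDensity c f ω) * Real.sqrt (configDensity d g ω) =
      configDensity (Real.sqrt c * Real.sqrt d)
        (fun x => Real.sqrt (f x) * Real.sqrt (g x)) ω := by
  rw [sqrt_configDensity hc hf, sqrt_configDensity hd hg]
  unfold configDensity
  rw [Finset.prod_mul_distrib, mul_mul_mul_comm, div_mul_div_comm,
    Real.mul_self_sqrt (by positivity)]

variable [MeasurableSpace E]

theorem measurable_sigmaMk_fin (n : ℕ) :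
    Measurable (fun x : Fin n → E => (⟨n, x⟩ : (n : ℕ) × (Fin n → E))) :=
  Measurable.of_le_map (iInf_le _ n)

theorem measurable_sigma_fin {β : Type*} [MeasurableSpace β] {g : (n : ℕ) × (Fin n → E) → β}
    (hg : ∀ n, Measurable fun x : Fin n → E => g ⟨n, x⟩) : Measurable g := by
  intro s hs
  exact MeasurableSpace.measurableSet_iInf.2 fun n => hg n hs

/-- The reference measure on finite configurations: the sum of all powers of `μ`. -/
noncomputable def configMeasure (μ : Measure E) : Measure ((n : ℕ) × (Fin n → E)) :=
  Measure.sum fun n => Measure.map (Sigma.mk n) (Measure.pi fun _ : Fin n => μ)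

theorem measurable_configDensity (hf : Measurable f) : Measurable (configDensity c f) :=
  measurable_sigma_fin fun n => by
    unfold configDensity
    have hprod : Measurable fun x : Fin n → E => ∏ i, f (x i) :=
      Finset.measurable_fun_prod _ fun i _ => hf.comp (measurable_pi_apply i)
    exact hprod.const_mul (c / n.factorial)

theorem pppLaw_withDensity (μ : Measure E) [SigmaFinite μ] (hfm : Measurable f)
    (hf : ∀ x, 0 ≤ f x) (hfi : Integrable f μ)
    [SigmaFinite (μ.withDensity fun x => ENNReal.ofReal (f x))] :
    pppLaw (μ.withDensity fun x => ENNReal.ofReal (f x)) =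
      (configMeasure μ).withDensity fun ω =>
        ENNReal.ofReal (configDensity (Real.exp (-∫ x, f x ∂μ)) f ω) := by
  have hmass : ((μ.withDensity fun x => ENNReal.ofReal (f x)) univ).toReal = ∫ x, f x ∂μ := by
    rw [withDensity_apply _ .univ, Measure.restrict_univ,
      integral_eq_lintegral_of_nonneg_ae (.of_forall hf) hfi.1]
  unfold pppLaw configMeasure
  rw [withDensity_sum, hmass]
  congr 1
  ext n s hs
  have hms : MeasurableSet ((fun x : Fin n → E => (⟨n, x⟩ : (n : ℕ) × (Fin n → E))) ⁻¹' s) :=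
    measurable_sigmaMk_fin n hs
  rw [Measure.smul_apply, Measure.map_apply (measurable_sigmaMk_fin n) hs, withDensity_apply _ hs,
    setLIntegral_map hs (measurable_configDensity hfm).ennreal_ofReal (measurable_sigmaMk_fin n),
    pi_fin_withDensity n μ _ hfm.ennreal_ofReal, withDensity_apply _ hms, smul_eq_mul,
    ← lintegral_const_mul _ (by fun_prop)]
  simp only [ofReal_configDensity (Real.exp_nonneg _) hf]

theorem lintegral_configDensity (μ : Measure E) [SigmaFinite μ] (hc : 0 ≤ c)
    (hfm : Measurable f) (hf : ∀ x, 0 ≤ f x) (hfi : Integrable f μ) :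
    ∫⁻ ω, ENNReal.ofReal (configDensity c f ω) ∂configMeasure μ =
      ENNReal.ofReal (c * Real.exp (∫ x, f x ∂μ)) := by
  have hI : 0 ≤ ∫ x, f x ∂μ := integral_nonneg hf
  have hsum := (NormedSpace.expSeries_div_hasSum_exp (∫ x, f x ∂μ)).mul_left c
  rw [← Real.exp_eq_exp_ℝ] at hsum
  unfold configMeasure
  rw [lintegral_sum_measure, ← hsum.tsum_eq,
    ENNReal.ofReal_tsum_of_nonneg (fun n => by positivity) hsum.summable]
  congr 1
  ext n
  rw [lintegral_map (measurable_configDensity hfm).ennreal_ofReal (measurable_sigmaMk_fin n)]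
  simp only [ofReal_configDensity hc hf]
  rw [lintegral_const_mul _ (by fun_prop),
    lintegral_pi_fin_prod n _ (fun _ x => ENNReal.ofReal (f x)) (fun _ => hfm.ennreal_ofReal),
    ← ofReal_integral_eq_lintegral_ofReal hfi (.of_forall hf), Finset.prod_const,
    Finset.card_univ, Fintype.card_fin, ← ENNReal.ofReal_pow hI, ← ENNReal.ofReal_natCast,
    ← ENNReal.ofReal_div_of_pos (by positivity), ← ENNReal.ofReal_mul (by positivity)]
  congr 1
  ring

theorem integrable_configDensity (μ : Measure E) [SigmaFinite μ] (hc : 0 ≤ c)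
    (hfm : Measurable f) (hf : ∀ x, 0 ≤ f x) (hfi : Integrable f μ) :
    Integrable (configDensity c f) (configMeasure μ) := by
  refine ⟨(measurable_configDensity hfm).aestronglyMeasurable, ?_⟩
  rw [hasFiniteIntegral_iff_ofReal (.of_forall (configDensity_nonneg hc hf)),
    lintegral_configDensity μ hc hfm hf hfi]
  exact ENNReal.ofReal_lt_top

theorem integral_configDensity (μ : Measure E) [SigmaFinite μ] (hc : 0 ≤ c)
    (hfm : Measurable f) (hf : ∀ x, 0 ≤ f x) (hfi : Integrable f μ) :
    ∫ ω, configDensity c f ω ∂configMeasure μ = c * Real.exp (∫ x, f x ∂μ) := by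
  rw [integral_eq_lintegral_of_nonneg_ae (.of_forall (configDensity_nonneg hc hf))
    (measurable_configDensity hfm).aestronglyMeasurable, lintegral_configDensity μ hc hfm hf hfi,
    ENNReal.toReal_ofReal (by positivity)]

end PoissonDensity


theorem stmt14 {E : Type*} [MeasurableSpace E] (μ : Measure E) [SigmaFinite μ]
    (lam₁ lam₂ : E → ℝ) (h1m : Measurable lam₁) (h2m : Measurable lam₂)
    (h10 : ∀ x, 0 ≤ lam₁ x) (h20 : ∀ x, 0 ≤ lam₂ x)
    (h1i : Integrable lam₁ μ) (h2i : Integrable lam₂ μ)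
    (ν₁ ν₂ : Measure E) [SigmaFinite ν₁] [SigmaFinite ν₂]
    (hν₁ : ν₁ = μ.withDensity (fun x => ENNReal.ofReal (lam₁ x)))
    (hν₂ : ν₂ = μ.withDensity (fun x => ENNReal.ofReal (lam₂ x))) :
    hellingerSq (pppLaw ν₁) (pppLaw ν₂) =
      2 * (1 - Real.exp (-(1 / 2) * ∫ x, (Real.sqrt (lam₁ x) - Real.sqrt (lam₂ x)) ^ 2 ∂μ)) ∧
    hellingerSq (pppLaw ν₁) (pppLaw ν₂) ≤
      ∫ x, (Real.sqrt (lam₁ x) - Real.sqrt (lam₂ x)) ^ 2 ∂μ := by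
  have hH : hellingerSq (pppLaw ν₁) (pppLaw ν₂) =
      2 * (1 - Real.exp (-(1 / 2) *
        ∫ x, (Real.sqrt (lam₁ x) - Real.sqrt (lam₂ x)) ^ 2 ∂μ)) := by
    subst hν₁ hν₂
    set c₁ := Real.exp (-∫ x, lam₁ x ∂μ) with hc₁
    set c₂ := Real.exp (-∫ x, lam₂ x ∂μ) with hc₂
    have hc₁0 : 0 ≤ c₁ := Real.exp_nonneg _
    have hc₂0 : 0 ≤ c₂ := Real.exp_nonneg _
    rw [pppLaw_withDensity μ h1m h10 h1i, pppLaw_withDensity μ h2m h20 h2i,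
      hellingerSq_withDensity (measurable_configDensity h1m) (measurable_configDensity h2m)
        (configDensity_nonneg hc₁0 h10) (configDensity_nonneg hc₂0 h20)
        (integrable_configDensity μ hc₁0 h1m h10 h1i) (integrable_configDensity μ hc₂0 h2m h20 h2i),
      integral_sqrt_sub_sqrt_sq (measurable_configDensity h1m) (measurable_configDensity h2m)
        (configDensity_nonneg hc₁0 h10) (configDensity_nonneg hc₂0 h20)
        (integrable_configDensity μ hc₁0 h1m h10 h1i) (integrable_configDensity μ hc₂0 h2m h20 h2i),
      integral_sqrt_sub_sqrt_sq h1m h2m h10 h20 h1i h2i]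
    simp only [sqrt_mul_sqrt_configDensity hc₁0 hc₂0 h10 h20]
    rw [integral_configDensity μ hc₁0 h1m h10 h1i, integral_configDensity μ hc₂0 h2m h20 h2i,
      integral_configDensity μ (by positivity) (by fun_prop) (fun x => by positivity)
        (integrable_sqrt_mul_sqrt h1m h2m h10 h20 h1i h2i),
      hc₁, hc₂, ← Real.exp_half, ← Real.exp_half, ← Real.exp_add, ← Real.exp_add, ← Real.exp_add,
      ← Real.exp_add, neg_add_cancel, neg_add_cancel, Real.exp_zero]
    ring_nf
  refine ⟨hH, hH.trans_le ?_⟩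
  linarith [Real.add_one_le_exp (-(1 / 2) *
    ∫ x, (Real.sqrt (lam₁ x) - Real.sqrt (lam₂ x)) ^ 2 ∂μ)]
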